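/- Fix m ≥ 1, n ≥ 2 and 1 ≤ i ≤ m−1. If a^1, …, a^{n−2}, b, c ∈ A(m), both b and c have a descent at i, and b_{i+1} ≤ c_{i+1}, then E_n(a^1, …, a^{n−2}, b, c⋆) ≤ E_n(a^1, …, a^{n−2}, b, c), where c⋆ = c^{⋆,i}. -/

import Mathlib

/-- `a` belongs to `A(m)`: integer sequences with `m ≥ a_1 ≥ ⋯ ≥ a_m ≥ 0`. -/
def memA (m : ℕ) (a : Fin m → ℤ) : Prop :=
  (∀ j, 0 ≤ a j) ∧ (∀ j, a j ≤ (m : ℤ)) ∧ Antitone a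

/-- Expectation of a sequence: `E(a) = (a_1 + ⋯ + a_m)/m²`. -/
noncomputable def Eseq {m : ℕ} (a : Fin m → ℤ) : ℝ :=
  (∑ j, (a j : ℝ)) / (m : ℝ) ^ 2

/-- Pointwise product of sequences: `(ab)_j = min(a_j, b_j)`. -/
def prodMin {m : ℕ} (a b : Fin m → ℤ) : Fin m → ℤ := fun j => min (a j) (b j)

/-- `a⁺ = a^{+,i}`: agrees with `a` except `(a⁺)_{i+1} = a_i` (here `i` is 0-based,
so positions `i, i+1` are the 1-based positions `i+1, i+2`). -/
def aPlus {m : ℕ} (a : Fin m → ℤ) (i : ℕ) (hi : i + 1 < m) : Fin m → ℤ :=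
  Function.update a ⟨i + 1, hi⟩ (a ⟨i, by omega⟩)

/-- `a⁻ = a^{−,i}`: agrees with `a` except `(a⁻)_i = a_{i+1}`. -/
def aMinus {m : ℕ} (a : Fin m → ℤ) (i : ℕ) (hi : i + 1 < m) : Fin m → ℤ :=
  Function.update a ⟨i, by omega⟩ (a ⟨i + 1, hi⟩)

/-- `a⋆ = a^{⋆,i}`: agrees with `a` except `(a⋆)_{i+1} = a_{i+1} + 1`. -/
def aStar {m : ℕ} (a : Fin m → ℤ) (i : ℕ) (hi : i + 1 < m) : Fin m → ℤ :=
  Function.update a ⟨i + 1, hi⟩ (a ⟨i + 1, hi⟩ + 1)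

/-- The orbits (cycles, counting fixed points as 1-cycles) of a permutation `σ`
of a finite index type, as a finset of finsets. -/
def permOrbits {ι : Type*} [Fintype ι] [DecidableEq ι] (σ : Equiv.Perm ι) : Finset (Finset ι) :=
  Finset.univ.image fun x => Finset.univ.filter fun y => σ.SameCycle x y

/-- The pointwise-min product `∏_{i ∈ O} aⁱ` of a family of sequences over a finset `O`.
(The fold starts at `m`; since all entries of sequences in `A(m)` are `≤ m` and orbits are
nonempty, this is the entrywise minimum over `O`.) -/
def seqProd {m : ℕ} {ι : Type*} (a : ι → Fin m → ℤ) (O : Finset ι) : Fin m → ℤ :=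
  fun j => O.fold min (m : ℤ) fun i => a i j

/-- Sahi's functional `E_n(a¹,…,aⁿ) = ∑_{σ ∈ S_n} (−1)^{C_σ−1} ∏_{O orbit of σ} E(∏_{i∈O} aⁱ)`
for sequences, with pointwise-min products. -/
noncomputable def EnSeq {m : ℕ} {ι : Type*} [Fintype ι] [DecidableEq ι]
    (a : ι → Fin m → ℤ) : ℝ :=
  ∑ σ : Equiv.Perm ι, (-1 : ℝ) ^ ((permOrbits σ).card - 1) *
    ∏ O ∈ permOrbits σ, Eseq (seqProd a O)

section CycleSum

variable {ι κ R : Type} [Fintype ι] [DecidableEq ι] [Fintype κ] [DecidableEq κ] [CommRing R]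

theorem permOrbits_eq_image_preimage (σ : Equiv.Perm ι) (τ : Equiv.Perm κ) (r : κ → ι)
    (hr : Function.Surjective r)
    (h : ∀ z w, τ.SameCycle z w ↔ σ.SameCycle (r z) (r w)) :
    permOrbits τ = (permOrbits σ).image fun O => Finset.univ.filter fun z => r z ∈ O := by
  ext O
  simp only [permOrbits, Finset.mem_image, Finset.mem_univ, true_and, exists_exists_eq_and,
    Finset.mem_filter, h]
  constructor
  · rintro ⟨z, rfl⟩
    exact ⟨r z, rfl⟩
  · rintro ⟨x, rfl⟩
    obtain ⟨z, rfl⟩ := hr x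
    exact ⟨z, rfl⟩

theorem prod_permOrbits_of_fiberwise (σ : Equiv.Perm ι) (τ : Equiv.Perm κ) (r : κ → ι)
    (hr : Function.Surjective r)
    (h : ∀ z w, τ.SameCycle z w ↔ σ.SameCycle (r z) (r w)) (φ : R → ℝ) (a : κ → R) :
    ∏ O ∈ permOrbits τ, φ (∏ i ∈ O, a i) =
      ∏ O ∈ permOrbits σ, φ (∏ i ∈ O, ∏ z with r z = i, a z) := by
  rw [permOrbits_eq_image_preimage σ τ r hr h, Finset.prod_image]
  · refine Finset.prod_congr rfl fun O _ => ?_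
    rw [← Finset.prod_fiberwise_of_maps_to (g := r) (t := O) (by simp)]
    congr 1
    refine Finset.prod_congr rfl fun i hi => Finset.prod_congr ?_ fun _ _ => rfl
    ext z
    simp only [Finset.mem_filter, Finset.mem_univ, true_and]
    exact ⟨fun hz => hz.2, fun hz => ⟨hz ▸ hi, hz⟩⟩
  · intro O _ O' _ hOO'
    ext x
    obtain ⟨z, rfl⟩ := hr x
    simpa using Finset.ext_iff.1 hOO' z

theorem sameCycle_swap_mul_optionCongr (σ : Equiv.Perm ι) (j : ι) (z w : Option ι) :
    (Equiv.swap none (some j) * Equiv.optionCongr σ).SameCycle z w ↔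
      σ.SameCycle (z.getD j) (w.getD j) := by
  set τ := Equiv.swap none (some j) * Equiv.optionCongr σ with hτ
  have hnone : τ none = some j := by simp [hτ]
  have hsome : ∀ x, τ (some x) = if σ x = j then none else some (σ x) := by
    intro x
    by_cases hx : σ x = j
    · simp [hτ, hx]
    · simp [hτ, hx, Equiv.swap_apply_of_ne_of_ne]
  have step : ∀ z, σ.SameCycle (z.getD j) ((τ z).getD j) := by
    rintro (_ | x)
    · simp [hnone, Equiv.Perm.SameCycle.refl]
    · have : (τ (some x)).getD j = σ x := by
        rw [hsome]; split_ifs with hx <;> simp [hx]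
      rw [this]
      simp [Equiv.Perm.SameCycle.refl]
  have lift : ∀ x, τ.SameCycle (some x) (some (σ x)) := by
    intro x
    by_cases hx : σ x = j
    · have h1 : τ (τ (some x)) = some (σ x) := by rw [hsome, if_pos hx, hnone, hx]
      rw [← h1]
      simp [Equiv.Perm.SameCycle.refl]
    · have h1 : τ (some x) = some (σ x) := by rw [hsome, if_neg hx]
      rw [← h1]
      simp [Equiv.Perm.SameCycle.refl]
  have hget : ∀ z : Option ι, τ.SameCycle z (some (z.getD j)) := by
    rintro (_ | x)
    · simp [← hnone, Equiv.Perm.SameCycle.refl]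
    · exact Equiv.Perm.SameCycle.refl _ _
  constructor
  · intro h
    obtain ⟨n, -, rfl⟩ := h.exists_pow_eq'
    clear h
    induction n with
    | zero => exact Equiv.Perm.SameCycle.refl _ _
    | succ n ih => rw [pow_succ']; exact ih.trans (step _)
  · intro h
    refine (hget z).trans (Equiv.Perm.SameCycle.trans ?_ (hget w).symm)
    obtain ⟨n, -, hn⟩ := h.exists_pow_eq'
    rw [← hn]
    generalize z.getD j = x
    clear hn h
    induction n with
    | zero => exact Equiv.Perm.SameCycle.refl _ _
    | succ n ih => rw [pow_succ']; exact ih.trans (lift _)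

theorem permOrbits_optionCongr (σ : Equiv.Perm ι) :
    permOrbits (Equiv.optionCongr σ) =
      insert {none} ((permOrbits σ).image fun O => O.map Function.Embedding.some) := by
  have hpow : ∀ n : ℤ, (Equiv.optionCongr σ : Equiv.Perm (Option ι)) ^ n =
      Equiv.optionCongr (σ ^ n) := fun n =>
    (map_zpow (MonoidHom.mk' (fun τ : Equiv.Perm ι => (Equiv.optionCongr τ : Equiv.Perm _))
      fun τ ρ => by ext x : 1; cases x <;> simp) σ n).symm
  have hnn : ∀ y : Option ι, Equiv.Perm.SameCycle (Equiv.optionCongr σ) none y ↔ y = none := by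
    intro y; simp [Equiv.Perm.SameCycle, hpow, eq_comm]
  have hss : ∀ x y, Equiv.Perm.SameCycle (Equiv.optionCongr σ) (some x) (some y) ↔
      σ.SameCycle x y := by
    intro x y; simp [Equiv.Perm.SameCycle, hpow]
  have hsn : ∀ x, ¬ Equiv.Perm.SameCycle (Equiv.optionCongr σ) (some x) none := by
    intro x; simp [Equiv.Perm.SameCycle, hpow]
  ext O
  simp only [permOrbits, Finset.mem_image, Finset.mem_univ, true_and, Finset.mem_insert,
    exists_exists_eq_and, Option.exists]
  refine or_congr ?_ (exists_congr fun x => ?_)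
  · rw [eq_comm]
    refine Eq.congr_right ?_
    ext y; simp [hnn]
  · refine Eq.congr_left ?_
    ext (_ | y) <;> simp [hss, hsn]

theorem prod_permOrbits_optionCongr (σ : Equiv.Perm ι) (φ : R → ℝ) (f : R) (a : ι → R) :
    ∏ O ∈ permOrbits (Equiv.optionCongr σ), φ (∏ i ∈ O, i.elim f a) =
      φ f * ∏ O ∈ permOrbits σ, φ (∏ i ∈ O, a i) := by
  rw [permOrbits_optionCongr, Finset.prod_insert, Finset.prod_image]
  · simp
  · intro O _ O' _ h
    exact Finset.map_injective _ h
  · simp only [Finset.mem_image, not_exists, not_and]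
    intro O _ h
    have := Finset.ext_iff.1 h none
    simp at this

variable [Algebra ℝ R]

/-- Sahi's functional for a linear form on a commutative algebra, with the sign of each
permutation distributed over its orbits. -/
noncomputable def cycleSum (L : R →ₗ[ℝ] ℝ) (a : ι → R) : ℝ :=
  -∑ σ : Equiv.Perm ι, ∏ O ∈ permOrbits σ, -(L (∏ i ∈ O, a i))

theorem cycleSum_comp_equiv (L : R →ₗ[ℝ] ℝ) (e : ι ≃ κ) (a : κ → R) :
    cycleSum L (fun i => a (e i)) = cycleSum L a := by
  unfold cycleSum
  congr 1
  refine Fintype.sum_equiv e.permCongr _ _ fun σ => ?_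
  rw [prod_permOrbits_of_fiberwise (e.permCongr σ) σ e e.surjective (fun z w => ?_)
    (fun x => -(L x)) (fun i => a (e i))]
  · refine Finset.prod_congr rfl fun O _ => ?_
    congr 2
    refine Finset.prod_congr rfl fun k _ => ?_
    rw [Finset.prod_eq_single (e.symm k)] <;> simp +contextual [Equiv.eq_symm_apply]
  · have hz : ∀ n : ℤ, ((e.permCongr σ) ^ n) (e z) = e ((σ ^ n) z) := fun n => by
      have : e.permCongr σ ^ n = e.permCongr (σ ^ n) :=
        (map_zpow e.permCongrHom σ n).symm
      simp [this]
    simp [Equiv.Perm.SameCycle, hz]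

/-- Removing one argument: it is either a fixed point or inserted in front of another index. -/
theorem cycleSum_option (L : R →ₗ[ℝ] ℝ) (f : R) (a : ι → R) :
    cycleSum L (fun o : Option ι => o.elim f a) =
      ∑ j, cycleSum L (Function.update a j (f * a j)) - L f * cycleSum L a := by
  unfold cycleSum
  rw [← Equiv.Perm.decomposeOption.symm.sum_comp, Fintype.sum_prod_type, Fintype.sum_option]
  have h1 : ∀ σ : Equiv.Perm ι,
      ∏ O ∈ permOrbits (Equiv.Perm.decomposeOption.symm (none, σ)), -L (∏ i ∈ O, i.elim f a) =
        -L f * ∏ O ∈ permOrbits σ, -L (∏ i ∈ O, a i) := fun σ => by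
    rw [← prod_permOrbits_optionCongr σ (fun x => -L x) f a]
    simp
    rfl
  have h2 : ∀ (j : ι) (σ : Equiv.Perm ι),
      ∏ O ∈ permOrbits (Equiv.Perm.decomposeOption.symm (some j, σ)), -L (∏ i ∈ O, i.elim f a) =
        ∏ O ∈ permOrbits σ, -L (∏ i ∈ O, Function.update a j (f * a j) i) := fun j σ => by
    change ∏ O ∈ permOrbits (Equiv.swap none (some j) * Equiv.optionCongr σ),
      -L (∏ i ∈ O, i.elim f a) = _
    rw [prod_permOrbits_of_fiberwise σ _ (fun z => z.getD j) (fun x => ⟨some x, rfl⟩)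
      (sameCycle_swap_mul_optionCongr σ j) (fun x => -L x)]
    refine Finset.prod_congr rfl fun O _ => ?_
    congr 2
    refine Finset.prod_congr rfl fun i _ => ?_
    rw [Finset.prod_filter, Fintype.prod_option]
    by_cases hij : i = j
    · subst hij; simp
    · simp [hij, Ne.symm hij]
  simp only [h1, h2, ← Finset.mul_sum, Finset.sum_neg_distrib]
  ring

theorem cycleSum_eq_option (L : R →ₗ[ℝ] ℝ) (j : ι) (a : ι → R) :
    cycleSum L a =
      cycleSum L (fun o : Option {x // x ≠ j} => o.elim (a j) fun x => a x) := by
  rw [← cycleSum_comp_equiv L (Equiv.optionSubtypeNe j) a]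
  congr 1
  ext (_ | x) <;> rfl

theorem cycleSum_update (L : R →ₗ[ℝ] ℝ) (j : ι) (a : ι → R) (g : R) :
    cycleSum L (Function.update a j g) =
      cycleSum L (fun o : Option {x // x ≠ j} => o.elim g fun x => a x) := by
  rw [cycleSum_eq_option L j]
  congr 1
  ext (_ | x)
  · simp
  · simp [x.2]

theorem cycleSum_option_erase (L : R →ₗ[ℝ] ℝ) (f : R) (a : ι → R) :
    cycleSum L (fun o : Option ι => o.elim f a) =
      ∑ j, cycleSum L (fun o : Option {x // x ≠ j} => o.elim (f * a j) fun x => a x) -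
        L f * cycleSum L a := by
  rw [cycleSum_option]
  simp only [cycleSum_update]

theorem card_ne_lt_card (j : ι) : Fintype.card {x // x ≠ j} < Fintype.card ι :=
  Fintype.card_subtype_lt (x := j) (by simp)

theorem isLinearMap_cycleSum_option (L : R →ₗ[ℝ] ℝ) (a : ι → R) :
    IsLinearMap ℝ fun f => cycleSum L (fun o : Option ι => o.elim f a) := by
  induction hn : Fintype.card ι using Nat.strong_induction_on generalizing ι with
  | _ n ih =>
    subst hn
    have ih' := fun j : ι => ih _ (card_ne_lt_card j) (fun x : {x // x ≠ j} => a x) rfl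
    constructor
    · intro f g
      simp only [cycleSum_option_erase L _ a, add_mul, (ih' _).map_add, map_add,
        Finset.sum_add_distrib]
      ring
    · intro r f
      simp only [cycleSum_option_erase L _ a, smul_mul_assoc, (ih' _).map_smul, map_smul,
        smul_eq_mul, ← Finset.mul_sum]
      ring

theorem isLinearMap_cycleSum_update (L : R →ₗ[ℝ] ℝ) (a : ι → R) (j : ι) :
    IsLinearMap ℝ fun f => cycleSum L (Function.update a j f) := by
  simpa only [cycleSum_update] using
    isLinearMap_cycleSum_option L fun x : {x // x ≠ j} => a x

/-- If `f` is orthogonal to a submonoid containing the remaining arguments, the cycle sum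
vanishes. -/
theorem cycleSum_option_eq_zero (L : R →ₗ[ℝ] ℝ) (G : Submonoid R) (a : ι → R)
    (ha : ∀ i, a i ∈ G) (f : R) (hf : ∀ g ∈ G, L (f * g) = 0) :
    cycleSum L (fun o : Option ι => o.elim f a) = 0 := by
  induction hn : Fintype.card ι using Nat.strong_induction_on generalizing ι f with
  | _ n ih =>
    subst hn
    have h0 : L f = 0 := by simpa using hf 1 G.one_mem
    rw [cycleSum_option_erase, h0, zero_mul, sub_zero]
    refine Finset.sum_eq_zero fun j _ => ih _ (card_ne_lt_card j)
      (fun x : {x // x ≠ j} => a x) (fun x => ha x) _ ?_ rfl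
    intro g hg
    rw [mul_assoc]
    exact hf _ (G.mul_mem (ha j) hg)

theorem cycleSum_option_of_mul_eq (L : R →ₗ[ℝ] ℝ) (a : ι → R) (f : R)
    (hf : ∀ i, f * a i = a i) :
    cycleSum L (fun o : Option ι => o.elim f a) = (Fintype.card ι - L f) * cycleSum L a := by
  simp only [cycleSum_option, hf, Function.update_eq_self, Finset.sum_const, Finset.card_univ,
    nsmul_eq_mul]
  ring

theorem cycleSum_of_isEmpty [IsEmpty ι] (L : R →ₗ[ℝ] ℝ) (a : ι → R) : cycleSum L a = -1 := by
  simp [cycleSum, permOrbits]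

/-- Cycle sums of chains are nonnegative. -/
theorem cycleSum_nonneg_of_chain [Nonempty ι] (L : R →ₗ[ℝ] ℝ) (a : ι → R) (r : ι → ℤ)
    (hr : ∀ i j, r i ≤ r j → a j * a i = a i) (h0 : ∀ i, 0 ≤ L (a i)) (h1 : ∀ i, L (a i) ≤ 1) :
    0 ≤ cycleSum L a := by
  induction hn : Fintype.card ι using Nat.strong_induction_on generalizing ι with
  | _ n ih =>
    subst hn
    obtain ⟨j, hj⟩ := Finite.exists_max r
    rw [cycleSum_eq_option L j,
      cycleSum_option_of_mul_eq L (fun x : {x // x ≠ j} => a x) _ fun i => hr i j (hj i)]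
    rcases isEmpty_or_nonempty {x // x ≠ j} with hempty | hne
    · simpa [cycleSum_of_isEmpty] using h0 j
    · refine mul_nonneg ?_ (ih _ (card_ne_lt_card j) (fun x : {x // x ≠ j} => a x) (fun x => r x)
        (fun x y => hr x y) (fun x => h0 x) (fun x => h1 x) rfl)
      have : (1 : ℝ) ≤ Fintype.card {x // x ≠ j} := by
        exact_mod_cast Fintype.card_pos
      linarith [h1 j]

end CycleSum

section Comparison

variable {Ω ι : Type} [Fintype ι] [DecidableEq ι]

/-- Cycle sums of at most `N` (and at least one) members of `K` are nonnegative. -/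
def CycleSumNonneg (L : (Ω → ℝ) →ₗ[ℝ] ℝ) (K : Set (Ω → ℝ)) (N : ℕ) : Prop :=
  ∀ (κ : Type) [Fintype κ] [DecidableEq κ] [Nonempty κ], Fintype.card κ ≤ N →
    ∀ a : κ → Ω → ℝ, (∀ i, a i ∈ K) → 0 ≤ cycleSum L a

theorem cycleSum_option_nonpos {L : (Ω → ℝ) →ₗ[ℝ] ℝ} (hL : ∀ f, 0 ≤ f → 0 ≤ L f)
    {K : Set (Ω → ℝ)} (hK : ∀ f ∈ K, 0 ≤ f) {N : ℕ} (hN : CycleSumNonneg L K N)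
    (hcard : Fintype.card ι ≤ N) (a : ι → Ω → ℝ) (ha : ∀ i, a i ∈ K) (i₀ : ι) (f : Ω → ℝ)
    (hf : 0 ≤ f) (hfi : f * a i₀ = 0) :
    cycleSum L (fun o : Option ι => o.elim f a) ≤ 0 := by
  induction hn : Fintype.card ι using Nat.strong_induction_on generalizing ι f with
  | _ n ih =>
    subst hn
    have hne : Nonempty ι := ⟨i₀⟩
    rw [cycleSum_option_erase]
    have hrest := mul_nonneg (hL f hf) (hN ι hcard a ha)
    refine sub_nonpos.2 (le_trans (Finset.sum_nonpos fun j _ => ?_) hrest)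
    by_cases hj : i₀ = j
    · subst hj
      rw [hfi]
      exact (isLinearMap_cycleSum_option L _).map_zero.le
    · refine ih _ (card_ne_lt_card j) ((card_ne_lt_card j).le.trans hcard)
        (fun x : {x // x ≠ j} => a x) (fun x => ha x) ⟨i₀, hj⟩ _ (mul_nonneg hf (hK _ (ha j))) ?_ rfl
      rw [mul_right_comm, hfi, zero_mul]

theorem cycleSum_update_le {L : (Ω → ℝ) →ₗ[ℝ] ℝ} (hL : ∀ f, 0 ≤ f → 0 ≤ L f)
    {K : Set (Ω → ℝ)} (hK : ∀ f ∈ K, 0 ≤ f) {N : ℕ} (hN : CycleSumNonneg L K N)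
    (hcard : Fintype.card ι ≤ N + 1) (a : ι → Ω → ℝ) (ha : ∀ i, a i ∈ K) {i₀ j : ι}
    (hj : i₀ ≠ j) (g : Ω → ℝ) (hg : a j ≤ g) (hgi : (g - a j) * a i₀ = 0) :
    cycleSum L (Function.update a j g) ≤ cycleSum L a := by
  have h := (isLinearMap_cycleSum_update L a j).map_sub g (a j)
  simp only [Function.update_eq_self] at h
  rw [← sub_nonpos, ← h, cycleSum_update]
  have := card_ne_lt_card j
  exact cycleSum_option_nonpos hL hK hN (by omega) (fun x : {x // x ≠ j} => a x)
    (fun x => ha x) ⟨i₀, hj⟩ _ (sub_nonneg.2 hg) hgi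

theorem cycleSum_anti_of_mul_eq_zero {L : (Ω → ℝ) →ₗ[ℝ] ℝ} (hL : ∀ f, 0 ≤ f → 0 ≤ L f)
    {K : Set (Ω → ℝ)} (hK : ∀ f ∈ K, 0 ≤ f) {N : ℕ} (hN : CycleSumNonneg L K N)
    (hcard : Fintype.card ι ≤ N + 1) (a b : ι → Ω → ℝ) (ha : ∀ i, a i ∈ K)
    (hb : ∀ i, b i ∈ K) (i₀ : ι) (h₀ : b i₀ = a i₀) (hab : ∀ i, a i ≤ b i)
    (hmul : ∀ i, i ≠ i₀ → (b i - a i) * a i₀ = 0) :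
    cycleSum L b ≤ cycleSum L a := by
  suffices h : ∀ s : Finset ι, cycleSum L (s.piecewise b a) ≤ cycleSum L a by
    simpa using h Finset.univ
  intro s
  induction s using Finset.induction_on with
  | empty => simp
  | insert j s hjs ih =>
    rw [Finset.piecewise_insert]
    refine le_trans ?_ ih
    have hj : s.piecewise b a j = a j := by simp [hjs]
    have hi₀ : s.piecewise b a i₀ = a i₀ := by simp [Finset.piecewise, h₀]
    by_cases hji : i₀ = j
    · subst hji
      rw [h₀, ← hi₀, Function.update_eq_self]
    · refine cycleSum_update_le hL hK hN hcard _ (fun i => ?_) hji _ ?_ ?_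
      · by_cases hi : i ∈ s <;> simp [hi, ha, hb]
      · rw [hj]; exact hab j
      · rw [hj, hi₀]; exact hmul j (Ne.symm hji)

end Comparison

section Diagram

variable {m : ℕ} {ι : Type} [DecidableEq ι]

/-- Expectation with respect to the uniform measure on the `m × m` grid. -/
noncomputable def gridExpect (m : ℕ) : (Fin m × Fin m → ℝ) →ₗ[ℝ] ℝ where
  toFun f := (∑ x, f x) / (m : ℝ) ^ 2
  map_add' f g := by simp [Finset.sum_add_distrib, add_div]
  map_smul' r f := by simp [← Finset.mul_sum, mul_div_assoc]

theorem gridExpect_nonneg (f : Fin m × Fin m → ℝ) (hf : 0 ≤ f) : 0 ≤ gridExpect m f :=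
  div_nonneg (Finset.sum_nonneg fun x _ => hf x) (by positivity)

theorem gridExpect_le_one (f : Fin m × Fin m → ℝ) (hf : f ≤ 1) : gridExpect m f ≤ 1 := by
  refine div_le_one_of_le₀ ?_ (by positivity)
  refine (Finset.sum_le_sum fun x _ => hf x).trans ?_
  simp [sq]

/-- Indicator function of the cells below the graph of `c`. -/
def diagram (c : Fin m → ℤ) : Fin m × Fin m → ℝ :=
  fun x => if ((x.2 : ℕ) : ℤ) < c x.1 then 1 else 0

theorem diagram_nonneg (c : Fin m → ℤ) : 0 ≤ diagram c := by
  intro x; simp only [diagram, Pi.zero_apply]; split_ifs <;> norm_num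

theorem diagram_le_one (c : Fin m → ℤ) : diagram c ≤ 1 := by
  intro x; simp only [diagram, Pi.one_apply]; split_ifs <;> norm_num

theorem diagram_mono {c d : Fin m → ℤ} (h : c ≤ d) : diagram c ≤ diagram d := by
  intro x
  have hx : c x.1 ≤ d x.1 := h x.1
  simp only [diagram]
  split_ifs <;> first | omega | norm_num

theorem diagram_mul_of_le {c d : Fin m → ℤ} (h : c ≤ d) : diagram d * diagram c = diagram c := by
  ext x
  have hx : c x.1 ≤ d x.1 := h x.1
  simp only [diagram, Pi.mul_apply]
  split_ifs <;> first | omega | norm_num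

theorem prod_diagram (a : ι → Fin m → ℤ) (O : Finset ι) :
    ∏ i ∈ O, diagram (a i) = diagram (seqProd a O) := by
  induction O using Finset.induction_on with
  | empty => ext x; simp [diagram, seqProd]
  | insert i O hi ih =>
    rw [Finset.prod_insert hi, ih]
    ext x
    simp only [diagram, seqProd, Pi.mul_apply, Finset.fold_insert hi, lt_min_iff]
    by_cases h1 : ((x.2 : ℕ) : ℤ) < a i x.1 <;>
      by_cases h2 : ((x.2 : ℕ) : ℤ) < O.fold min (m : ℤ) (fun i => a i x.1) <;>
      simp only [h1, h2, and_true, and_false, if_true, if_false, mul_one, mul_zero]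

theorem sum_ite_lt_eq (c : ℤ) (h0 : 0 ≤ c) (hm : c ≤ m) :
    ∑ h : Fin m, (if ((h : ℕ) : ℤ) < c then (1 : ℝ) else 0) = c := by
  lift c to ℕ using h0
  rw [Fin.sum_univ_eq_sum_range (fun h => if (h : ℤ) < (c : ℤ) then (1 : ℝ) else 0)]
  have : (Finset.range m).filter (fun h => h < c) = Finset.range c := by
    ext h; simp; omega
  simp [this]

theorem gridExpect_diagram (c : Fin m → ℤ) (h0 : ∀ j, 0 ≤ c j) (hm : ∀ j, c j ≤ m) :
    gridExpect m (diagram c) = Eseq c := by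
  simp only [gridExpect, LinearMap.coe_mk, AddHom.coe_mk, diagram, Eseq, Fintype.sum_prod_type]
  simp only [sum_ite_lt_eq _ (h0 _) (hm _)]

variable [Fintype ι]

theorem EnSeq_eq_cycleSum [Nonempty ι] (a : ι → Fin m → ℤ) (h0 : ∀ i j, 0 ≤ a i j) :
    EnSeq a = cycleSum (gridExpect m) fun i => diagram (a i) := by
  unfold EnSeq cycleSum
  rw [← Finset.sum_neg_distrib]
  refine Finset.sum_congr rfl fun σ _ => ?_
  have hO : ∀ O : Finset ι, gridExpect m (∏ i ∈ O, diagram (a i)) = Eseq (seqProd a O) := by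
    intro O
    rw [prod_diagram]
    refine gridExpect_diagram _ (fun j => ?_) fun j => ?_
    · exact (Finset.le_fold_min _).2 ⟨by positivity, fun i _ => h0 i j⟩
    · exact (Finset.fold_min_le _).2 (Or.inl le_rfl)
  have hcard : (permOrbits σ).card ≠ 0 := by
    simp [permOrbits, Finset.univ_nonempty.ne_empty]
  obtain ⟨k, hk⟩ := Nat.exists_eq_succ_of_ne_zero hcard
  simp only [hO, Finset.prod_neg, hk, Nat.succ_sub_one, pow_succ]
  ring

/-- The sequence equal to `c` before position `p` and to `v` from `p` on. -/
def withTail (c : Fin m → ℤ) (p : ℕ) (v : ℤ) : Fin m → ℤ :=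
  fun j => if (j : ℕ) < p then c j else v

theorem memA_withTail {c : Fin m → ℤ} (hc : memA m c) {p : ℕ} {k : Fin m} (hk : p ≤ k) :
    memA m (withTail c p (c k)) := by
  obtain ⟨h0, hm, hanti⟩ := hc
  refine ⟨fun j => ?_, fun j => ?_, fun j l hjl => ?_⟩
  · unfold withTail; split_ifs <;> apply h0
  · unfold withTail; split_ifs <;> apply hm
  · have hjl' : (j : ℕ) ≤ l := hjl
    unfold withTail
    split_ifs
    · exact hanti hjl
    · omega
    · exact hanti (show (j : ℕ) ≤ k by omega)
    · exact le_rfl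

/-- Functions on the grid that do not depend on the column from column `p` on. -/
def tailConst (m : ℕ) (p : Fin m) : Submonoid (Fin m × Fin m → ℝ) where
  carrier := {g | ∀ j h, p ≤ j → g (j, h) = g (p, h)}
  one_mem' := by simp
  mul_mem' := by
    intro f g hf hg j h hj
    simp only [Pi.mul_apply, hf j h hj, hg j h hj]

/-- Averaging a sequence over the columns from `p` on, tested against functions
constant on these columns. -/
theorem gridExpect_tail_average (p : Fin m) (c : Fin m → ℤ) (v : ℤ)
    (hv : ∀ j, p < j → c j = v) (g : Fin m × Fin m → ℝ) (hg : g ∈ tailConst m p) :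
    gridExpect m (((m - p : ℝ) • diagram c - (diagram (withTail c p (c p)) +
      (m - p - 1 : ℝ) • diagram (withTail c p v))) * g) = 0 := by
  have key : ∀ j h, (((m - p : ℝ) • diagram c - (diagram (withTail c p (c p)) +
      (m - p - 1 : ℝ) • diagram (withTail c p v))) * g) (j, h) =
      ((if ((h : ℕ) : ℤ) < c p then 1 else 0) - (if ((h : ℕ) : ℤ) < v then 1 else 0)) * g (p, h) *
        ((if j = p then (m - p : ℝ) else 0) - (if p ≤ j then 1 else 0)) := by
    intro j h
    simp only [Pi.mul_apply, Pi.sub_apply, Pi.add_apply, Pi.smul_apply, smul_eq_mul, diagram,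
      withTail, Fin.val_fin_lt]
    rcases lt_trichotomy j p with hj | rfl | hj
    · simp only [if_pos hj, hj.ne, not_le.2 hj, if_false]
      ring
    · simp only [lt_irrefl, le_refl, if_false, if_true]
      ring
    · simp only [not_lt.2 hj.le, hj.ne', hj.le, if_false, if_true, hv j hj, hg j h hj.le]
      ring
  have hcount : ∑ j : Fin m, (if p ≤ j then (1 : ℝ) else 0) = m - p := by
    have : Finset.univ.filter (fun j : Fin m => p ≤ j) = Finset.Ici p := by ext; simp
    simp [this, Fin.card_Ici, Nat.cast_sub p.2.le]
  simp only [gridExpect, LinearMap.coe_mk, AddHom.coe_mk]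
  rw [Fintype.sum_prod_type_right]
  simp only [key, ← Finset.mul_sum, Finset.sum_sub_distrib, hcount, Finset.sum_ite_eq',
    Finset.mem_univ, if_true, sub_self, mul_zero, Finset.sum_const_zero, zero_div]

/-- The indicator functions of the diagrams of the members of `A(m)`. -/
def diagrams (m : ℕ) : Set (Fin m × Fin m → ℝ) := diagram '' {c | memA m c}

theorem nonneg_of_mem_diagrams : ∀ f ∈ diagrams m, 0 ≤ f := by
  rintro _ ⟨c, _, rfl⟩
  exact diagram_nonneg c

theorem cycleSum_diagram_nonneg_of_tail {N : ℕ}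
    (hN : CycleSumNonneg (gridExpect m) (diagrams m) N) [Nonempty ι]
    (hcard : Fintype.card ι ≤ N + 1) (p : ℕ) (hp : p < m) (a : ι → Fin m → ℤ)
    (ha : ∀ i, memA m (a i)) (htail : ∀ i j, (⟨p, hp⟩ : Fin m) ≤ j → a i j = a i ⟨p, hp⟩) :
    0 ≤ cycleSum (gridExpect m) fun i => diagram (a i) := by
  induction p generalizing a with
  | zero =>
    refine cycleSum_nonneg_of_chain _ _ (fun i => a i ⟨0, hp⟩) (fun i j hij => ?_)
      (fun i => gridExpect_nonneg _ (diagram_nonneg _))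
      (fun i => gridExpect_le_one _ (diagram_le_one _))
    refine diagram_mul_of_le fun k => ?_
    rw [htail i k (Nat.zero_le _), htail j k (Nat.zero_le _)]
    exact hij
  | succ p ih =>
    have hp' : p < m := by omega
    set P : Fin m := ⟨p, hp'⟩ with hP
    set Q : Fin m := ⟨p + 1, hp⟩ with hQ
    have hPQ : P ≤ Q := Nat.le_succ p
    have hQj : ∀ j, P < j → Q ≤ j := fun j hj => hj
    have hflat : ∀ c : Fin m → ℤ, ∀ v j, P ≤ j → withTail c p v j = v := by
      intro c v j hj
      exact if_neg (not_lt.2 hj)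
    obtain ⟨i₀, hi₀⟩ := Finite.exists_min fun i => a i Q
    let b : ι → Fin m → ℤ :=
      fun i => if i = i₀ then a i else withTail (a i) p (a i P)
    have hb : ∀ i, memA m (b i) := by
      intro i
      by_cases hi : i = i₀
      · simp only [b, if_pos hi, ha]
      · simp only [b, if_neg hi]
        exact memA_withTail (ha i) le_rfl
    have hle : ∀ i, a i ≤ withTail (a i) p (a i P) := by
      intro i j
      unfold withTail
      split_ifs with hj
      · exact le_rfl
      · exact (ha i).2.2 (not_lt.1 hj)
    have hanti : cycleSum (gridExpect m) (fun i => diagram (b i)) ≤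
        cycleSum (gridExpect m) fun i => diagram (a i) := by
      refine cycleSum_anti_of_mul_eq_zero gridExpect_nonneg nonneg_of_mem_diagrams hN hcard
        _ _ (fun i => ⟨_, ha i, rfl⟩) (fun i => ⟨_, hb i, rfl⟩) i₀ (by simp [b]) (fun i => ?_)
        fun i hi => ?_
      · refine diagram_mono ?_
        by_cases hi : i = i₀
        · simp [b, hi]
        · simpa [b, hi] using hle i
      · ext ⟨j, h⟩
        simp only [b, if_neg hi, Pi.mul_apply, Pi.sub_apply, Pi.zero_apply, diagram]
        rcases lt_trichotomy j P with hj | rfl | hj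
        · have : withTail (a i) p (a i P) j = a i j := if_pos hj
          simp [this]
        · simp [hflat]
        · rw [hflat _ _ _ hj.le, htail i j (hQj j hj), htail i₀ j (hQj j hj)]
          have hmin := hi₀ i
          have hdesc := (ha i).2.2 hPQ
          split_ifs <;> first | omega | norm_num
    refine le_trans ?_ hanti
    have hupd : ∀ k : Fin m, P ≤ k → 0 ≤ cycleSum (gridExpect m)
        (Function.update (fun i => diagram (b i)) i₀ (diagram (withTail (a i₀) p (a i₀ k)))) := by
      intro k hk
      have := ih hp' (Function.update b i₀ (withTail (a i₀) p (a i₀ k))) (fun i => ?_)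
        fun i j hj => ?_
      · convert this using 2
        ext i : 1
        by_cases hi : i = i₀
        · subst hi; simp
        · simp [hi]
      · by_cases hi : i = i₀
        · subst hi
          simpa using memA_withTail (ha i) (p := p) hk
        · simpa [hi] using hb i
      · by_cases hi : i = i₀
        · subst hi
          simp only [Function.update_self]
          rw [hflat _ _ _ hj, hflat _ _ _ le_rfl]
        · simp only [Function.update_of_ne hi, b, if_neg hi]
          rw [hflat _ _ _ hj, hflat _ _ _ le_rfl]
    have hlin := isLinearMap_cycleSum_update (gridExpect m) (fun i => diagram (b i)) i₀
    have hzero : cycleSum (gridExpect m) (Function.update (fun i => diagram (b i)) i₀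
        ((m - P : ℝ) • diagram (a i₀) - (diagram (withTail (a i₀) p (a i₀ P)) +
          (m - P - 1 : ℝ) • diagram (withTail (a i₀) p (a i₀ Q))))) = 0 := by
      rw [cycleSum_update]
      refine cycleSum_option_eq_zero _ (tailConst m P)
        (fun x : {x // x ≠ i₀} => diagram (b x)) (fun x j h hj => ?_) _
        (gridExpect_tail_average P (a i₀) (a i₀ Q) fun j hj => htail i₀ j (hQj j hj))
      simp only [b, if_neg x.2, diagram]
      rw [hflat _ _ _ hj, hflat _ _ _ le_rfl]
    rw [hlin.map_sub, hlin.map_add, hlin.map_smul, hlin.map_smul] at hzero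
    have hself : Function.update (fun i => diagram (b i)) i₀ (diagram (a i₀)) =
        fun i => diagram (b i) := by
      rw [Function.update_eq_self_iff]; simp [b]
    simp only [hself, smul_eq_mul] at hzero
    have hpm : (p : ℝ) + 1 < m := by exact_mod_cast hp
    have h2 := mul_nonneg (show (0 : ℝ) ≤ m - P - 1 by simp only [hP]; linarith) (hupd Q hPQ)
    have h1 := hupd P le_rfl
    have hpos : (0 : ℝ) < m - P := by simp only [hP]; linarith
    exact nonneg_of_mul_nonneg_right (by linarith) hpos

theorem cycleSumNonneg_diagrams (hm : 1 ≤ m) (N : ℕ) :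
    CycleSumNonneg (gridExpect m) (diagrams m) N := by
  induction N with
  | zero =>
    intro κ _ _ _ hcard
    exact absurd hcard (not_le.2 Fintype.card_pos)
  | succ N ih =>
    intro κ _ _ _ hcard a ha
    choose c hc hca using ha
    obtain rfl : (fun i => diagram (c i)) = a := funext hca
    refine cycleSum_diagram_nonneg_of_tail ih hcard (m - 1) (by omega) c hc fun i j hj => ?_
    have hj' : m - 1 ≤ (j : ℕ) := hj
    congr
    ext
    simp only
    omega

end Diagram

/-- If `a¹,…,aⁿ⁻²,b,c ∈ A(m)` (here there are `n + 2` sequences in all: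
`g = (a¹,…,aⁿ⁻²)`, `b` and `c`), both `b` and `c` have a descent at `i`, and
`b_{i+1} ≤ c_{i+1}`, then `E_n(a¹,…,aⁿ⁻²,b,c⋆) ≤ E_n(a¹,…,aⁿ⁻²,b,c)`. -/
theorem stmt_15 (m : ℕ) (hm : 1 ≤ m) (i : ℕ) (hi : i + 1 < m) (n : ℕ)
    (g : Fin n → Fin m → ℤ) (hg : ∀ l, memA m (g l))
    (b c : Fin m → ℤ) (hb : memA m b) (hc : memA m c)
    (hdesb : b ⟨i + 1, hi⟩ < b ⟨i, by omega⟩)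
    (hdesc : c ⟨i + 1, hi⟩ < c ⟨i, by omega⟩)
    (hbc : b ⟨i + 1, hi⟩ ≤ c ⟨i + 1, hi⟩) :
    EnSeq (Fin.snoc (Fin.snoc g b) (aStar c i hi))
      ≤ EnSeq (Fin.snoc (Fin.snoc g b) c) := by
  have hP : i < m := by omega
  set P : Fin m := ⟨i, hP⟩
  set Q : Fin m := ⟨i + 1, hi⟩ with hQ
  set fam : Fin (n + 2) → Fin m → ℤ := Fin.snoc (Fin.snoc g b) c with hfam
  have hlast : fam (Fin.last (n + 1)) = c := by simp [hfam]
  have hpen : fam (Fin.last n).castSucc = b := by simp [hfam]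
  have hmem : ∀ l, memA m (fam l) := by
    intro l
    refine Fin.lastCases (by rwa [hlast]) (fun l => ?_) l
    refine Fin.lastCases (by rwa [hpen]) (fun l => ?_) l
    simpa [hfam] using hg l
  have hstar : (Fin.snoc (Fin.snoc g b) (aStar c i hi) : Fin (n + 2) → Fin m → ℤ) =
      Function.update fam (Fin.last (n + 1)) (aStar c i hi) := by
    rw [hfam, Fin.update_snoc_last]
  have hge : c ≤ aStar c i hi := by
    intro j
    by_cases hj : j = Q
    · subst hj; simp [aStar, hQ]
    · simp [aStar, ← hQ, hj]
  rw [hstar, EnSeq_eq_cycleSum fam fun l => (hmem l).1, EnSeq_eq_cycleSum]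
  · have hupd : (fun l => diagram (Function.update fam (Fin.last (n + 1)) (aStar c i hi) l)) =
        Function.update (fun l => diagram (fam l)) (Fin.last (n + 1))
          (diagram (aStar c i hi)) := by
      ext l : 1
      by_cases hl : l = Fin.last (n + 1)
      · subst hl; simp
      · simp [hl]
    rw [hupd]
    refine cycleSum_update_le gridExpect_nonneg nonneg_of_mem_diagrams
      (cycleSumNonneg_diagrams hm (n + 1)) (by simp) _ (fun l => ⟨_, hmem l, rfl⟩)
      (i₀ := (Fin.last n).castSucc) (Fin.castSucc_lt_last _).ne _ ?_ ?_
    · rw [hlast]; exact diagram_mono hge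
    · rw [hlast, hpen]
      ext ⟨j, h⟩
      by_cases hj : j = Q
      · subst hj
        simp only [diagram, aStar, Pi.mul_apply, Pi.sub_apply, Pi.zero_apply, ← hQ,
          Function.update_self]
        split_ifs <;> first | omega | norm_num
      · simp [diagram, aStar, ← hQ, hj]
  · intro l j
    by_cases hl : l = Fin.last (n + 1)
    · subst hl
      simpa using (hc.1 j).trans (hge j)
    · simpa [hl] using (hmem l).1 j
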